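/- Let $K$ be a field and work in the projective 3-space $\mathbb{P}(K^4)$. Three points are called collinear if their representative vectors are linearly dependent; a quadrangle is an ordered quadruple of points no three of which are collinear; a plane is a 3-dimensional subspace of $K^4$, and a point lies on it if the corresponding 1-dimensional subspace is contained in it. Quadrangles $P Q R S$ and $P' Q' R' S'$ are perspective from a point $X$ if each of the triples $(X,P,P')$, $(X,Q,Q')$, $(X,R,R')$, $(X,S,S')$ is collinear. Let $\pi$ be a plane, and let $P_1 Q_1 R_1 S_1$ and $P_2 Q_2 R_2 S_2$ be two different quadrangles (that is, at least one of $P_1\neq P_2$, $Q_1\neq Q_2$, $R_1\neq R_2$, $S_1\neq S_2$ holds) all of whose vertices lie on $\pi$, perspective from a point $O$ lying on $\pi$. Suppose their diagonal triangles are perspective from $O$, in the sense that: for all points $A_1$ collinear with $S_1, P_1$ and with $Q_1, R_1$, and $A_2$ collinear with $S_2, P_2$ and with $Q_2, R_2$, the triple $(O, A_1, A_2)$ is collinear; for all points $B_1$ collinear with $S_1, Q_1$ and with $R_1, P_1$, and $B_2$ collinear with $S_2, Q_2$ and with $R_2, P_2$, the triple $(O, B_1, B_2)$ is collinear; and for all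 points $C_1$ collinear with $S_1, R_1$ and with $P_1, Q_1$, and $C_2$ collinear with $S_2, R_2$ and with $P_2, Q_2$, the triple $(O, C_1, C_2)$ is collinear. Then there exist a plane $\bar\pi\neq\pi$, points $O_1\neq O_2$, neither lying on $\bar\pi$ nor on $\pi$, and a quadrangle $\bar P\bar Q\bar R\bar S$ all of whose vertices lie on $\bar\pi$, such that $P_1 Q_1 R_1 S_1$ and $\bar P\bar Q\bar R\bar S$ are perspective from $O_1$, and $\bar P\bar Q\bar R\bar S$ and $P_2 Q_2 R_2 S_2$ are perspective from $O_2$. -/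

import Mathlib

/-- Three points of projective 3-space are collinear if their representative
vectors are linearly dependent. -/
def Col (K : Type*) [Field K] (a b c : Projectivization K (Fin 4 → K)) : Prop :=
  ¬ Projectivization.Independent ![a, b, c]

/-- A quadrangle: four points, no three of which are collinear. -/
def IsQuadrangle (K : Type*) [Field K] (P Q R S : Projectivization K (Fin 4 → K)) : Prop :=
  ¬ Col K P Q R ∧ ¬ Col K P Q S ∧ ¬ Col K P R S ∧ ¬ Col K Q R S

open Projectivization in
theorem col_iff_of_submodule_eq_span {K : Type*} [Field K]
    {P Q R : Projectivization K (Fin 4 → K)} {p q r : Fin 4 → K}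
    (hp : P.submodule = K ∙ p) (hq : Q.submodule = K ∙ q) (hr : R.submodule = K ∙ r) :
    Col K P Q R ↔ ¬ LinearIndependent K ![p, q, r] := by
  have ne_zero : ∀ {X : Projectivization K (Fin 4 → K)} {x : Fin 4 → K},
      X.submodule = K ∙ x → x ≠ 0 := by
    rintro X x hx rfl
    have := X.finrank_submodule
    rw [hx, Submodule.span_zero_singleton, finrank_bot] at this
    exact zero_ne_one this
  have hne : ∀ i, ![p, q, r] i ≠ 0 := by
    intro i
    fin_cases i
    exacts [ne_zero hp, ne_zero hq, ne_zero hr]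
  rw [Col, independent_iff_iSupIndep, ← iSupIndep_iff_linearIndependent_of_ne_zero hne]
  have : (fun i => (![P, Q, R] i).submodule) = fun i => K ∙ (![p, q, r] i) := by
    funext i
    fin_cases i
    exacts [hp, hq, hr]
  rw [this]

theorem col_iff_det_eq_zero {K : Type*} [Field K]
    {P Q R : Projectivization K (Fin 4 → K)} {E : (Fin 3 → K) →ₗ[K] (Fin 4 → K)}
    (hE : Function.Injective E) {x y z : Fin 3 → K}
    (hx : P.submodule = K ∙ E x) (hy : Q.submodule = K ∙ E y) (hz : R.submodule = K ∙ E z) :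
    Col K P Q R ↔ (Matrix.of ![x, y, z]).det = 0 := by
  rw [col_iff_of_submodule_eq_span hx hy hz]
  have h : ![E x, E y, E z] = E ∘ ![x, y, z] := by
    funext i
    fin_cases i <;> rfl
  have h' := Matrix.linearIndependent_rows_iff_isUnit (A := Matrix.of ![x, y, z])
  rw [Matrix.isUnit_iff_isUnit_det, isUnit_iff_ne_zero] at h'
  rw [h, E.linearIndependent_iff_of_injOn hE.injOn, ← not_iff_not, not_not, ← ne_eq, ← h']
  rfl

/-- Coordinates on a plane in which a given quadrangle is the standard one. -/
theorem IsQuadrangle.exists_frame {K : Type*} [Field K]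
    {P Q R S : Projectivization K (Fin 4 → K)} (hq : IsQuadrangle K P Q R S)
    {π : Submodule K (Fin 4 → K)} (hπ : Module.finrank K π = 3)
    (hP : P.submodule ≤ π) (hQ : Q.submodule ≤ π) (hR : R.submodule ≤ π) (hS : S.submodule ≤ π) :
    ∃ E : (Fin 3 → K) →ₗ[K] (Fin 4 → K), Function.Injective E ∧ LinearMap.range E = π ∧
      P.submodule = K ∙ E ![1, 0, 0] ∧ Q.submodule = K ∙ E ![0, 1, 0] ∧
      R.submodule = K ∙ E ![0, 0, 1] ∧ S.submodule = K ∙ E ![1, 1, 1] := by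
  obtain ⟨h₁, h₂, h₃, h₄⟩ := hq
  let D : (Fin 3 → K) →ₗ[K] (Fin 4 → K) := Fintype.linearCombination K ![P.rep, Q.rep, R.rep]
  have hD : ∀ x, D x = x 0 • P.rep + x 1 • Q.rep + x 2 • R.rep := fun x => by
    simp [D, Fintype.linearCombination_apply, Fin.sum_univ_three]
  have hinj : Function.Injective D := by
    rw [col_iff_of_submodule_eq_span P.submodule_eq Q.submodule_eq R.submodule_eq, not_not] at h₁
    exact linearIndependent_iff_injective_fintypeLinearCombination.mp h₁
  have mem : ∀ {X : Projectivization K (Fin 4 → K)}, X.submodule ≤ π → X.rep ∈ π := fun {X} h =>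
    h (X.submodule_eq ▸ Submodule.mem_span_singleton_self _)
  have range_eq : ∀ E : (Fin 3 → K) →ₗ[K] (Fin 4 → K), Function.Injective E →
      LinearMap.range E ≤ π → LinearMap.range E = π := fun E hE h =>
    Submodule.eq_of_le_of_finrank_eq h (by simp [LinearMap.finrank_range_of_inj hE, hπ])
  have hDle : LinearMap.range D ≤ π := by
    rintro _ ⟨x, rfl⟩
    rw [hD]
    exact π.add_mem (π.add_mem (π.smul_mem _ (mem hP)) (π.smul_mem _ (mem hQ)))
      (π.smul_mem _ (mem hR))
  obtain ⟨c, hc⟩ : S.rep ∈ LinearMap.range D := range_eq D hinj hDle ▸ mem hS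
  have sP : P.submodule = K ∙ D ![1, 0, 0] := by simp [hD, P.submodule_eq]
  have sQ : Q.submodule = K ∙ D ![0, 1, 0] := by simp [hD, Q.submodule_eq]
  have sR : R.submodule = K ∙ D ![0, 0, 1] := by simp [hD, R.submodule_eq]
  have sS : S.submodule = K ∙ D c := by rw [hc, S.submodule_eq]
  rw [col_iff_det_eq_zero hinj sP sQ sS] at h₂
  rw [col_iff_det_eq_zero hinj sP sR sS] at h₃
  rw [col_iff_det_eq_zero hinj sQ sR sS] at h₄
  simp [Matrix.det_fin_three] at h₂ h₃ h₄
  let T : (Fin 3 → K) →ₗ[K] (Fin 3 → K) := LinearMap.mulLeft K c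
  have hT : Function.Injective T := by
    intro x y hxy
    have h := fun i => congrFun hxy i
    simp only [T, LinearMap.mulLeft_apply, Pi.mul_apply] at h
    funext i
    fin_cases i
    exacts [mul_left_cancel₀ h₄ (h 0), mul_left_cancel₀ h₃ (h 1), mul_left_cancel₀ h₂ (h 2)]
  have hDT : Function.Injective (D ∘ₗ T) := hinj.comp hT
  refine ⟨D ∘ₗ T, hDT, range_eq _ hDT ((LinearMap.range_comp_le_range T D).trans hDle),
    ?_, ?_, ?_, ?_⟩
  · simp [hD, T, P.submodule_eq, Submodule.span_singleton_smul_eq (Ne.isUnit h₄)]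
  · simp [hD, T, Q.submodule_eq, Submodule.span_singleton_smul_eq (Ne.isUnit h₃)]
  · simp [hD, T, R.submodule_eq, Submodule.span_singleton_smul_eq (Ne.isUnit h₂)]
  · simp [hD, T, S.submodule_eq, ← hc]

/-- A linear endomorphism `F` of `K³` such that the quadratic form `det (o, x, F x)` vanishes at the
basis vectors and at their pairwise sums is a scalar up to a map into the line spanned by `o`. -/
theorem exists_eq_smul_add_smul {K : Type*} [Field K] {o : Fin 3 → K} (ho : o ≠ 0)
    (F : (Fin 3 → K) →ₗ[K] (Fin 3 → K))
    (hF : ∀ x ∈ ({![1, 0, 0], ![0, 1, 0], ![0, 0, 1], ![0, 1, 1], ![1, 0, 1], ![1, 1, 0]} :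
      Set (Fin 3 → K)), (Matrix.of ![o, x, F x]).det = 0) :
    ∃ (l : K) (φ : (Fin 3 → K) →ₗ[K] K), ∀ x, F x = l • x + φ x • o := by
  obtain ⟨M, rfl⟩ := Matrix.toLin'.surjective F
  simp only [Set.mem_insert_iff, Set.mem_singleton_iff, forall_eq_or_imp, forall_eq,
    Matrix.det_fin_three] at hF
  simp [Matrix.mulVec, dotProduct, Fin.sum_univ_three] at hF
  obtain ⟨e₀, e₁, e₂, e₁₂, e₀₂, e₀₁⟩ := hF
  suffices ∃ (l : K) (f : Fin 3 → K),
      ∀ i j, M i j = (if i = j then l else 0) + f j * o i by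
    obtain ⟨l, f, h⟩ := this
    refine ⟨l, Fintype.linearCombination K f, fun x => ?_⟩
    funext i
    simp [Matrix.mulVec, dotProduct, Fin.sum_univ_three, h, Fintype.linearCombination_apply]
    fin_cases i <;> simp <;> ring
  have : o 0 ≠ 0 ∨ o 1 ≠ 0 ∨ o 2 ≠ 0 := by
    by_contra! h
    exact ho (funext fun i => by fin_cases i <;> simp [h])
  rcases this with h | h | h
  · refine ⟨M 1 1 - M 0 1 * o 1 / o 0,
      ![(M 0 0 - (M 1 1 - M 0 1 * o 1 / o 0)) / o 0, M 0 1 / o 0, M 0 2 / o 0], ?_⟩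
    intro i j
    fin_cases i <;> fin_cases j <;> simp <;> field_simp <;> grind
  · refine ⟨M 2 2 - M 1 2 * o 2 / o 1,
      ![M 1 0 / o 1, (M 1 1 - (M 2 2 - M 1 2 * o 2 / o 1)) / o 1, M 1 2 / o 1], ?_⟩
    intro i j
    fin_cases i <;> fin_cases j <;> simp <;> field_simp <;> grind
  · refine ⟨M 0 0 - M 2 0 * o 0 / o 2,
      ![M 2 0 / o 2, M 2 1 / o 2, (M 2 2 - (M 0 0 - M 2 0 * o 0 / o 2)) / o 2], ?_⟩
    intro i j
    fin_cases i <;> fin_cases j <;> simp <;> field_simp <;> grind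

theorem ne_zero_of_injective_eq_smul_add_smul {K : Type*} [Field K] {o : Fin 3 → K}
    {F : (Fin 3 → K) →ₗ[K] (Fin 3 → K)} (hF : Function.Injective F) {l : K}
    {φ : (Fin 3 → K) →ₗ[K] K} (h : ∀ x, F x = l • x + φ x • o) : l ≠ 0 := by
  rintro rfl
  have hφ : Function.Injective φ := fun x y hxy => hF (by simp [h, hxy])
  simpa using LinearMap.finrank_le_finrank_of_injective hφ

/-- A nontrivial central collineation `x ↦ l x + φ(x) o` of a plane is the product of two
perspectivities, through a second plane and from two centers outside both planes. -/
theorem exists_perspectivities_of_eq_smul_add_smul {K : Type*} [Field K]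
    {E : (Fin 3 → K) →ₗ[K] (Fin 4 → K)} (hE : Function.Injective E) {o : Fin 3 → K} (ho : o ≠ 0)
    {F : (Fin 3 → K) →ₗ[K] (Fin 3 → K)} (hF : Function.Injective F) {l : K}
    {φ : (Fin 3 → K) →ₗ[K] K} (hφ : φ ≠ 0) (h : ∀ x, F x = l • x + φ x • o) :
    ∃ (G : (Fin 3 → K) →ₗ[K] (Fin 4 → K)) (a b : Fin 4 → K), Function.Injective G ∧
      LinearMap.range G ≠ LinearMap.range E ∧ LinearIndependent K ![a, b] ∧
      a ∉ LinearMap.range G ∧ a ∉ LinearMap.range E ∧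
      b ∉ LinearMap.range G ∧ b ∉ LinearMap.range E ∧
      ∀ x, ¬ LinearIndependent K ![a, E x, G x] ∧ ¬ LinearIndependent K ![b, G x, E (F x)] := by
  have hl := ne_zero_of_injective_eq_smul_add_smul hF h
  obtain ⟨w, hw⟩ : ∃ w, w ∉ LinearMap.range E := by
    by_contra! hall
    simpa using LinearMap.finrank_le_finrank_of_surjective (f := E) hall
  have hcoef : ∀ (x : Fin 3 → K) (t : K), t • w + E x = 0 → t = 0 ∧ x = 0 := by
    intro x t hx
    have ht : t = 0 := by
      by_contra ht
      refine hw ⟨t⁻¹ • -x, ?_⟩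
      rw [map_smul, map_neg, ← eq_neg_of_add_eq_zero_left hx, inv_smul_smul₀ ht]
    refine ⟨ht, hE ?_⟩
    simpa [ht] using hx
  have hG : ∀ x, (E + (l⁻¹ • φ).smulRight w) x = E x + (l⁻¹ * φ x) • w := fun x => by simp
  refine ⟨E + (l⁻¹ • φ).smulRight w, w, w - E o, ?_, ?_, ?_, ?_, hw, ?_, ?_, fun x => ⟨?_, ?_⟩⟩
  · rw [← LinearMap.ker_eq_bot, LinearMap.ker_eq_bot']
    intro x hx
    rw [hG, add_comm] at hx
    exact (hcoef _ _ hx).2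
  · intro heq
    refine hφ (LinearMap.ext fun x => ?_)
    obtain ⟨y, hy⟩ : (E + (l⁻¹ • φ).smulRight w) x ∈ LinearMap.range E := heq ▸ ⟨x, rfl⟩
    rw [hG] at hy
    have := (hcoef (x - y) (l⁻¹ * φ x) (by rw [map_sub, hy]; abel)).1
    simpa [hl] using this
  · rw [LinearIndependent.pair_iff]
    intro s t hst
    obtain ⟨h₁, h₂⟩ := hcoef (-t • o) (s + t) (by rw [← hst, map_smul]; module)
    have ht : t = 0 := by simpa [ho] using h₂
    exact ⟨by simpa [ht] using h₁, ht⟩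
  · rintro ⟨x, hx⟩
    rw [hG] at hx
    obtain ⟨h₁, rfl⟩ := hcoef x (l⁻¹ * φ x - 1) (by
      rw [sub_smul, one_smul, ← sub_eq_zero.mpr hx]; abel)
    simp at h₁
  · rintro ⟨x, hx⟩
    rw [hG] at hx
    obtain ⟨h₁, h₂⟩ := hcoef (x + o) (l⁻¹ * φ x - 1) (by
      rw [sub_smul, map_add, one_smul, ← sub_eq_zero.mpr hx]; abel)
    obtain rfl := eq_neg_of_add_eq_zero_left h₂
    have hlo : φ o = -l := by
      rw [map_neg] at h₁
      field_simp at h₁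
      linear_combination -h₁
    exact ho (hF (by rw [h, hlo, map_zero]; module))
  · rintro ⟨x, hx⟩
    obtain ⟨h₁, -⟩ := hcoef (x + o) (-1) (by rw [map_add, hx]; module)
    simp at h₁
  · rw [Fintype.not_linearIndependent_iff]
    refine ⟨![-(l⁻¹ * φ x), -1, 1], ?_, 1, by simp⟩
    simp [Fin.sum_univ_three]
  · rw [Fintype.not_linearIndependent_iff]
    refine ⟨![-φ x, l, -1], ?_, 1, by simpa using hl⟩
    simp only [Fin.sum_univ_three, hG, h]
    simp [mul_smul, hl]
    module

theorem exists_submodule_eq_span {K V : Type*} [Field K] [AddCommGroup V] [Module K V] {v : V}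
    (hv : v ≠ 0) : ∃ P : Projectivization K V, P.submodule = K ∙ v :=
  ⟨.mk K v hv, rfl⟩

theorem coplanar_perspective_quadrangles_are_shadows
    {K : Type*} [Field K]
    (π : Submodule K (Fin 4 → K)) (hπ3 : Module.finrank K π = 3)
    (O P₁ Q₁ R₁ S₁ P₂ Q₂ R₂ S₂ : Projectivization K (Fin 4 → K))
    (hO : O.submodule ≤ π)
    (hq1 : IsQuadrangle K P₁ Q₁ R₁ S₁)
    (hq2 : IsQuadrangle K P₂ Q₂ R₂ S₂)
    (hne : ¬ (P₁ = P₂ ∧ Q₁ = Q₂ ∧ R₁ = R₂ ∧ S₁ = S₂))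
    (hP₁ : P₁.submodule ≤ π) (hQ₁ : Q₁.submodule ≤ π)
    (hR₁ : R₁.submodule ≤ π) (hS₁ : S₁.submodule ≤ π)
    (hP₂ : P₂.submodule ≤ π) (hQ₂ : Q₂.submodule ≤ π)
    (hR₂ : R₂.submodule ≤ π) (hS₂ : S₂.submodule ≤ π)
    (hperspP : Col K O P₁ P₂) (hperspQ : Col K O Q₁ Q₂)
    (hperspR : Col K O R₁ R₂) (hperspS : Col K O S₁ S₂)
    (hA : ∀ A₁ A₂ : Projectivization K (Fin 4 → K),
      Col K S₁ P₁ A₁ → Col K Q₁ R₁ A₁ → Col K S₂ P₂ A₂ → Col K Q₂ R₂ A₂ →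
      Col K O A₁ A₂)
    (hB : ∀ B₁ B₂ : Projectivization K (Fin 4 → K),
      Col K S₁ Q₁ B₁ → Col K R₁ P₁ B₁ → Col K S₂ Q₂ B₂ → Col K R₂ P₂ B₂ →
      Col K O B₁ B₂)
    (hC : ∀ C₁ C₂ : Projectivization K (Fin 4 → K),
      Col K S₁ R₁ C₁ → Col K P₁ Q₁ C₁ → Col K S₂ R₂ C₂ → Col K P₂ Q₂ C₂ →
      Col K O C₁ C₂) :
    ∃ (πb : Submodule K (Fin 4 → K)) (O₁ O₂ Pb Qb Rb Sb : Projectivization K (Fin 4 → K)),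
      Module.finrank K πb = 3 ∧ πb ≠ π ∧
      O₁ ≠ O₂ ∧
      ¬ O₁.submodule ≤ πb ∧ ¬ O₁.submodule ≤ π ∧
      ¬ O₂.submodule ≤ πb ∧ ¬ O₂.submodule ≤ π ∧
      IsQuadrangle K Pb Qb Rb Sb ∧
      Pb.submodule ≤ πb ∧ Qb.submodule ≤ πb ∧ Rb.submodule ≤ πb ∧ Sb.submodule ≤ πb ∧
      Col K O₁ P₁ Pb ∧ Col K O₁ Q₁ Qb ∧ Col K O₁ R₁ Rb ∧ Col K O₁ S₁ Sb ∧
      Col K O₂ Pb P₂ ∧ Col K O₂ Qb Q₂ ∧ Col K O₂ Rb R₂ ∧ Col K O₂ Sb S₂ := by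
  obtain ⟨E, hE, hEπ, sP₁, sQ₁, sR₁, sS₁⟩ := hq1.exists_frame hπ3 hP₁ hQ₁ hR₁ hS₁
  obtain ⟨E', hE', hEπ', sP₂, sQ₂, sR₂, sS₂⟩ := hq2.exists_frame hπ3 hP₂ hQ₂ hR₂ hS₂
  subst hEπ
  obtain ⟨F, rfl⟩ : ∃ F : (Fin 3 → K) →ₗ[K] (Fin 3 → K), E ∘ₗ F = E' :=
    ⟨(LinearEquiv.ofInjective E hE).symm.toLinearMap ∘ₗ
      LinearMap.codRestrict (LinearMap.range E) E' fun x => hEπ' ▸ LinearMap.mem_range_self E' x,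
      LinearMap.ext fun x => by
        exact congrArg Subtype.val ((LinearEquiv.ofInjective E hE).apply_symm_apply
          ⟨E' x, hEπ' ▸ LinearMap.mem_range_self E' x⟩)⟩
  have hF : Function.Injective F := Function.Injective.of_comp hE'
  obtain ⟨o, ho⟩ : O.rep ∈ LinearMap.range E :=
    hO (O.submodule_eq ▸ Submodule.mem_span_singleton_self _)
  have sO : O.submodule = K ∙ E o := by rw [ho, O.submodule_eq]
  have ho0 : o ≠ 0 := by
    rintro rfl
    exact O.rep_nonzero (by rw [← ho, map_zero])
  have hdiag : ∀ {X₁ Y₁ Z₁ W₁ X₂ Y₂ Z₂ W₂ : Projectivization K (Fin 4 → K)}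
      {x y z w d : Fin 3 → K},
      X₁.submodule = K ∙ E x → Y₁.submodule = K ∙ E y →
      Z₁.submodule = K ∙ E z → W₁.submodule = K ∙ E w →
      X₂.submodule = K ∙ E (F x) → Y₂.submodule = K ∙ E (F y) →
      Z₂.submodule = K ∙ E (F z) → W₂.submodule = K ∙ E (F w) → d ≠ 0 →
      (Matrix.of ![x, y, d]).det = 0 → (Matrix.of ![z, w, d]).det = 0 →
      (∀ A₁ A₂, Col K X₁ Y₁ A₁ → Col K Z₁ W₁ A₁ → Col K X₂ Y₂ A₂ → Col K Z₂ W₂ A₂ →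
        Col K O A₁ A₂) → (Matrix.of ![o, d, F d]).det = 0 := by
    intro X₁ Y₁ Z₁ W₁ X₂ Y₂ Z₂ W₂ x y z w d hx hy hz hw hx' hy' hz' hw' hd h₁ h₂ H
    obtain ⟨A₁, hA₁⟩ := exists_submodule_eq_span (K := K) ((map_ne_zero_iff E hE).mpr hd)
    obtain ⟨A₂, hA₂⟩ := exists_submodule_eq_span (K := K) ((map_ne_zero_iff (E ∘ₗ F) hE').mpr hd)
    exact (col_iff_det_eq_zero hE sO hA₁ hA₂).mp <| H A₁ A₂
      ((col_iff_det_eq_zero hE hx hy hA₁).mpr h₁) ((col_iff_det_eq_zero hE hz hw hA₁).mpr h₂)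
      ((col_iff_det_eq_zero hE' hx' hy' hA₂).mpr h₁) ((col_iff_det_eq_zero hE' hz' hw' hA₂).mpr h₂)
  obtain ⟨l, φ, hlφ⟩ := exists_eq_smul_add_smul ho0 F (by
    rintro x (rfl | rfl | rfl | rfl | rfl | rfl)
    · exact (col_iff_det_eq_zero hE sO sP₁ sP₂).mp hperspP
    · exact (col_iff_det_eq_zero hE sO sQ₁ sQ₂).mp hperspQ
    · exact (col_iff_det_eq_zero hE sO sR₁ sR₂).mp hperspR
    · exact hdiag sS₁ sP₁ sQ₁ sR₁ sS₂ sP₂ sQ₂ sR₂ (by simp) (by simp [Matrix.det_fin_three])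
        (by simp [Matrix.det_fin_three]) hA
    · exact hdiag sS₁ sQ₁ sR₁ sP₁ sS₂ sQ₂ sR₂ sP₂ (by simp) (by simp [Matrix.det_fin_three])
        (by simp [Matrix.det_fin_three]) hB
    · exact hdiag sS₁ sR₁ sP₁ sQ₁ sS₂ sR₂ sP₂ sQ₂ (by simp) (by simp [Matrix.det_fin_three])
        (by simp [Matrix.det_fin_three]) hC)
  have hl := ne_zero_of_injective_eq_smul_add_smul hF hlφ
  have hφ : φ ≠ 0 := by
    rintro rfl
    have heq : ∀ {X Y : Projectivization K (Fin 4 → K)} {x : Fin 3 → K},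
        X.submodule = K ∙ E x → Y.submodule = K ∙ E (F x) → X = Y := by
      intro X Y x hX hY
      refine Projectivization.submodule_injective ?_
      rw [hX, hY, hlφ]
      simp [Submodule.span_singleton_smul_eq (Ne.isUnit hl)]
    exact hne ⟨heq sP₁ sP₂, heq sQ₁ sQ₂, heq sR₁ sR₂, heq sS₁ sS₂⟩
  obtain ⟨G, a, b, hG, hGE, hab, haG, haE, hbG, hbE, hpersp⟩ :=
    exists_perspectivities_of_eq_smul_add_smul hE ho0 hF hφ hlφ
  obtain ⟨O₁, sO₁⟩ := exists_submodule_eq_span (K := K) (v := a) (hab.ne_zero 0)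
  obtain ⟨O₂, sO₂⟩ := exists_submodule_eq_span (K := K) (v := b) (hab.ne_zero 1)
  have hpt : ∀ x : Fin 3 → K, x ≠ 0 →
      ∃ X : Projectivization K (Fin 4 → K), X.submodule = K ∙ G x := fun x hx =>
    exists_submodule_eq_span ((map_ne_zero_iff G hG).mpr hx)
  obtain ⟨P, sP⟩ := hpt ![1, 0, 0] (by simp)
  obtain ⟨Q, sQ⟩ := hpt ![0, 1, 0] (by simp)
  obtain ⟨R, sR⟩ := hpt ![0, 0, 1] (by simp)
  obtain ⟨S, sS⟩ := hpt ![1, 1, 1] (by simp)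
  have hle : ∀ {X : Projectivization K (Fin 4 → K)} {v : Fin 4 → K}
      {p : Submodule K (Fin 4 → K)}, X.submodule = K ∙ v → (X.submodule ≤ p ↔ v ∈ p) := by
    intro X v p hX
    rw [hX, Submodule.span_singleton_le_iff_mem]
  refine ⟨LinearMap.range G, O₁, O₂, P, Q, R, S, ?_, hGE, ?_, mt (hle sO₁).mp haG,
    mt (hle sO₁).mp haE, mt (hle sO₂).mp hbG, mt (hle sO₂).mp hbE, ⟨?_, ?_, ?_, ?_⟩,
    (hle sP).mpr ⟨_, rfl⟩, (hle sQ).mpr ⟨_, rfl⟩, (hle sR).mpr ⟨_, rfl⟩, (hle sS).mpr ⟨_, rfl⟩,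
    (col_iff_of_submodule_eq_span sO₁ sP₁ sP).mpr (hpersp _).1,
    (col_iff_of_submodule_eq_span sO₁ sQ₁ sQ).mpr (hpersp _).1,
    (col_iff_of_submodule_eq_span sO₁ sR₁ sR).mpr (hpersp _).1,
    (col_iff_of_submodule_eq_span sO₁ sS₁ sS).mpr (hpersp _).1,
    (col_iff_of_submodule_eq_span sO₂ sP sP₂).mpr (hpersp _).2,
    (col_iff_of_submodule_eq_span sO₂ sQ sQ₂).mpr (hpersp _).2,
    (col_iff_of_submodule_eq_span sO₂ sR sR₂).mpr (hpersp _).2,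
    (col_iff_of_submodule_eq_span sO₂ sS sS₂).mpr (hpersp _).2⟩
  · simp [LinearMap.finrank_range_of_inj hG]
  · rintro rfl
    have hb : b ∈ K ∙ a := by
      rw [← sO₁, sO₂]
      exact Submodule.mem_span_singleton_self b
    obtain ⟨t, ht⟩ := Submodule.mem_span_singleton.mp hb
    exact (LinearIndependent.pair_iff' (hab.ne_zero 0)).mp hab t ht
  · rw [col_iff_det_eq_zero hG sP sQ sR]
    simp [Matrix.det_fin_three]
  · rw [col_iff_det_eq_zero hG sP sQ sS]
    simp [Matrix.det_fin_three]
  · rw [col_iff_det_eq_zero hG sP sR sS]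
    simp [Matrix.det_fin_three]
  · rw [col_iff_det_eq_zero hG sQ sR sS]
    simp [Matrix.det_fin_three]
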